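/- There is a satisfiable HyperLTL sentence that is not satisfied by any set of traces containing an ultimately periodic trace: there exists a HyperLTL sentence φ over a finite set AP of atomic propositions such that some set of traces satisfies φ, but for every set of traces T with T ⊨ φ, no trace in T is ultimately periodic. -/

import Mathlib

/-- A trace over a set `AP` of atomic propositions: an infinite word over `2^AP`. -/
abbrev Trace (AP : Type) : Type := ℕ → Set AP

/-- Quantifier-free HyperLTL formulas over atomic propositions `AP`
and trace variables `V`: `ψ ::= a_π | ¬ψ | ψ∨ψ | Xψ | ψUψ`. -/
inductive QF (AP V : Type) : Type
  | atom : AP → V → QF AP V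
  | not  : QF AP V → QF AP V
  | or   : QF AP V → QF AP V → QF AP V
  | next : QF AP V → QF AP V
  | untl : QF AP V → QF AP V → QF AP V

/-- HyperLTL formulas in prenex form: `φ ::= ∃π.φ | ∀π.φ | ψ`. -/
inductive HyperLTL (AP V : Type) : Type
  | exi : V → HyperLTL AP V → HyperLTL AP V
  | all : V → HyperLTL AP V → HyperLTL AP V
  | qf  : QF AP V → HyperLTL AP V

/-- `Π[j,∞)`: shift every trace of the assignment forward by `j` positions. -/
def shiftAsgn {AP V : Type} (ρ : V → Trace AP) (j : ℕ) : V → Trace AP :=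
  fun v n => ρ v (n + j)

/-- Satisfaction of quantifier-free HyperLTL formulas w.r.t. a trace assignment. -/
def QF.sat {AP V : Type} (ρ : V → Trace AP) : QF AP V → Prop
  | atom a π => a ∈ ρ π 0
  | not ψ => ¬ ψ.sat ρ
  | or ψ₁ ψ₂ => ψ₁.sat ρ ∨ ψ₂.sat ρ
  | next ψ => ψ.sat (shiftAsgn ρ 1)
  | untl ψ₁ ψ₂ => ∃ j, ψ₂.sat (shiftAsgn ρ j) ∧ ∀ j' < j, ψ₁.sat (shiftAsgn ρ j')

/-- Satisfaction of HyperLTL formulas over a set `T` of traces and a trace assignment. -/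
def HyperLTL.sat {AP V : Type} [DecidableEq V] (T : Set (Trace AP)) (ρ : V → Trace AP) :
    HyperLTL AP V → Prop
  | exi π φ => ∃ t ∈ T, φ.sat T (Function.update ρ π t)
  | all π φ => ∀ t ∈ T, φ.sat T (Function.update ρ π t)
  | qf ψ => ψ.sat ρ

/-- Free trace variables of a quantifier-free formula. -/
def QF.free {AP V : Type} : QF AP V → Set V
  | atom _ π => {π}
  | not ψ => ψ.free
  | or ψ₁ ψ₂ => ψ₁.free ∪ ψ₂.free
  | next ψ => ψ.free
  | untl ψ₁ ψ₂ => ψ₁.free ∪ ψ₂.free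

/-- Free trace variables of a HyperLTL formula. -/
def HyperLTL.free {AP V : Type} : HyperLTL AP V → Set V
  | exi π φ => φ.free \ {π}
  | all π φ => φ.free \ {π}
  | qf ψ => ψ.free

/-- A HyperLTL sentence: a closed formula. -/
def HyperLTL.Closed {AP V : Type} (φ : HyperLTL AP V) : Prop := φ.free = ∅

/-- `T ⊨ φ` for a sentence `φ`: satisfaction w.r.t. the empty (here: trivial)
trace assignment, which is irrelevant for sentences. -/
def HyperLTL.Models {AP V : Type} [DecidableEq V] (T : Set (Trace AP))
    (φ : HyperLTL AP V) : Prop :=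
  φ.sat T (fun _ _ => ∅)

/-- Conjunction, as a derived operator. -/
def QF.and {AP V : Type} (ψ₁ ψ₂ : QF AP V) : QF AP V := .not (.or ψ₁.not ψ₂.not)

/-- Eventually: `F ψ = true U ψ` (with `true` built from `ψ`). -/
def QF.ev {AP V : Type} (ψ : QF AP V) : QF AP V := .untl (.or ψ ψ.not) ψ

/-- Always: `G ψ = ¬F¬ψ`. -/
def QF.alw {AP V : Type} (ψ : QF AP V) : QF AP V := (QF.ev ψ.not).not

/-- A trace is ultimately periodic if there are `s, p > 0` with `t(n) = t(n+p)`
for all `n ≥ s`. -/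
def UltimatelyPeriodic {AP : Type} (t : Trace AP) : Prop :=
  ∃ s p : ℕ, 0 < s ∧ 0 < p ∧ ∀ n ≥ s, t n = t (n + p)

namespace QF

variable {AP V : Type} (ρ : V → Trace AP) (ψ ψ₁ ψ₂ : QF AP V)

theorem sat_and : (QF.and ψ₁ ψ₂).sat ρ ↔ ψ₁.sat ρ ∧ ψ₂.sat ρ := by
  simp [QF.and, QF.sat]

theorem sat_ev : (QF.ev ψ).sat ρ ↔ ∃ j, ψ.sat (shiftAsgn ρ j) := by
  simp [QF.ev, QF.sat, em]

theorem sat_alw : (QF.alw ψ).sat ρ ↔ ∀ j, ψ.sat (shiftAsgn ρ j) := by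
  simp [QF.alw, sat_ev, QF.sat]

end QF

/-- The set of positions `B` eventually contains `A` and meets the interior of every gap of `A`. -/
def EventuallyRefines (A B : Set ℕ) : Prop :=
  ∃ s, ∀ n ≥ s, n ∈ A → n ∈ B ∧
    ∃ j, (n + 1 + j ∈ B ∧ n + 1 + j ∉ A) ∧ ∀ i < j, n + 1 + i ∉ A

/-- Every window of length `g` starting late enough meets `A`. -/
def EventuallyMeetsWindows (A : Set ℕ) (g : ℕ) : Prop :=
  ∃ s, ∀ n ≥ s, ∃ i < g, n + i ∈ A

theorem EventuallyRefines.meetsWindows {A B : Set ℕ} (h : EventuallyRefines A B) {g : ℕ}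
    (hA : EventuallyMeetsWindows A (g + 1)) : EventuallyMeetsWindows B g := by
  obtain ⟨s, hs⟩ := h
  obtain ⟨r, hr⟩ := hA
  refine ⟨s + r + 1, fun n hn => ?_⟩
  by_contra! hB
  have hnA : ∀ i < g, n + i ∉ A := fun i hi hmem => hB i hi (hs _ (by lia) hmem).1
  obtain ⟨i, hi, hiA⟩ := hr (n - 1) (by lia)
  have hi0 : i = 0 := by
    by_contra h0
    exact hnA (i - 1) (by lia) (by rwa [show n + (i - 1) = n - 1 + i by lia])
  obtain ⟨l, hl, hlA⟩ := hr n (by lia)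
  have hlg : l = g := by
    by_contra h0
    exact hnA l (by lia) hlA
  subst hi0 hlg
  obtain ⟨-, j, ⟨hjB, hjA⟩, hj⟩ := hs (n - 1) (by lia) hiA
  rw [show n - 1 + 1 + j = n + j by lia] at hjB hjA
  rcases lt_trichotomy j l with h1 | h1 | h1
  · exact hB j h1 hjB
  · exact hjA (h1 ▸ hlA)
  · exact hj l h1 (by rwa [show n - 1 + 1 + l = n + l by lia])

/-- The positions of a trace at which the unique atomic proposition holds. -/
def Trace.marks (t : Trace (Fin 1)) : Set ℕ := {n | 0 ∈ t n}

theorem UltimatelyPeriodic.exists_meetsWindows {t : Trace (Fin 1)} (ht : UltimatelyPeriodic t)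
    (hinf : ∀ n, ∃ j, n + j ∈ t.marks) : ∃ g, EventuallyMeetsWindows t.marks g := by
  obtain ⟨s, p, -, hp, hper⟩ := ht
  refine ⟨p, s, fun n hn => ?_⟩
  have hmul : ∀ k m, s ≤ m → t m = t (m + k * p) := by
    intro k
    induction k with
    | zero => simp
    | succ k ih =>
      intro m hm
      rw [ih m hm, hper _ (by lia)]
      congr 1
      ring
  obtain ⟨j, hj⟩ := hinf n
  refine ⟨j % p, Nat.mod_lt _ hp, ?_⟩
  have h := hmul (j / p) (n + j % p) (by lia)
  rw [add_assoc, mul_comm, Nat.mod_add_div] at h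
  simpa [Trace.marks, h] using hj

/-- The quantifier-free formula stating that the marks of trace `0` are infinite in number and
that they are eventually refined by the marks of trace `1`. -/
def refinementMatrix : QF (Fin 1) ℕ :=
  .and (.alw (.ev (.atom 0 0)))
    (.ev (.alw (.or (.not (.atom 0 0))
      (.and (.atom 0 1)
        (.next (.untl (.not (.atom 0 0)) (.and (.atom 0 1) (.not (.atom 0 0)))))))))

theorem sat_refinementMatrix (ρ : ℕ → Trace (Fin 1)) :
    refinementMatrix.sat ρ ↔
      (∀ n, ∃ j, n + j ∈ (ρ 0).marks) ∧ EventuallyRefines (ρ 0).marks (ρ 1).marks := by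
  simp only [refinementMatrix, QF.sat_and, QF.sat_alw, QF.sat_ev, QF.sat, shiftAsgn,
    EventuallyRefines, Trace.marks, Set.mem_ofPred_eq, zero_add, ← imp_iff_not_or]
  refine and_congr (forall_congr' fun n => exists_congr fun j => by rw [add_comm]) ?_
  refine exists_congr fun s => ⟨fun h n hn => ?_, fun h n => ?_⟩
  · obtain ⟨m, rfl⟩ := Nat.exists_eq_add_of_le hn
    simpa [add_comm, add_left_comm, add_assoc] using h m
  · have := h (n + s) (by lia)
    simpa [add_comm, add_left_comm, add_assoc] using this

/-- A sentence stating that there is a trace, and that every trace has infinitely many marks,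
which are eventually refined by those of some trace. -/
def refinementSentence : HyperLTL (Fin 1) ℕ :=
  .exi 2 (.all 0 (.exi 1 (.qf refinementMatrix)))

theorem refinementSentence_closed : refinementSentence.Closed := by
  ext v
  simp [refinementSentence, refinementMatrix, HyperLTL.free, QF.free, QF.and, QF.ev, QF.alw]

theorem models_refinementSentence (T : Set (Trace (Fin 1))) :
    refinementSentence.Models T ↔ T.Nonempty ∧ ∀ t ∈ T,
      (∀ n, ∃ j, n + j ∈ t.marks) ∧ ∃ u ∈ T, EventuallyRefines t.marks u.marks := by
  simp only [HyperLTL.Models, refinementSentence, HyperLTL.sat, sat_refinementMatrix]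
  simp [Set.Nonempty, and_left_comm (b := ∀ n, _)]

theorem not_ultimatelyPeriodic_of_models {T : Set (Trace (Fin 1))}
    (hT : refinementSentence.Models T) {t : Trace (Fin 1)} (ht : t ∈ T) :
    ¬ UltimatelyPeriodic t := by
  obtain ⟨-, hT⟩ := (models_refinementSentence T).1 hT
  have key : ∀ g, ∀ u ∈ T, ¬ EventuallyMeetsWindows u.marks g := by
    intro g
    induction g with
    | zero =>
      rintro u - ⟨s, hs⟩
      simpa using hs s le_rfl
    | succ g ih =>
      intro u hu hg
      obtain ⟨v, hv, huv⟩ := (hT u hu).2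
      exact ih v hv (huv.meetsWindows hg)
  intro hper
  obtain ⟨g, hg⟩ := hper.exists_meetsWindows (hT t ht).1
  exact key g t ht hg

/-- The trace marked at the positions `⌊n² / 4ᵏ⌋`. -/
def scaledSquares (k : ℕ) : Trace (Fin 1) := fun m => {_a | ∃ n, n ^ 2 / 4 ^ k = m}

theorem exists_add_mem_marks_scaledSquares (k n : ℕ) :
    ∃ j, n + j ∈ (scaledSquares k).marks := by
  have h : n ≤ (2 ^ k * n) ^ 2 / 4 ^ k := by
    rw [mul_pow, ← pow_mul, mul_comm k 2, pow_mul]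
    norm_num
    exact Nat.le_self_pow two_ne_zero n
  exact ⟨(2 ^ k * n) ^ 2 / 4 ^ k - n, 2 ^ k * n, by lia⟩

theorem eventuallyRefines_scaledSquares (k : ℕ) :
    EventuallyRefines (scaledSquares k).marks (scaledSquares (k + 1)).marks := by
  refine ⟨(4 ^ (k + 1)) ^ 2, ?_⟩
  rintro m hm ⟨n, rfl⟩
  have hc : 0 < 4 ^ (k + 1) := by positivity
  have hn : 4 ^ (k + 1) ≤ n :=
    (Nat.pow_le_pow_iff_left two_ne_zero).1 (hm.trans (Nat.div_le_self _ _))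
  have hdouble : ∀ l, l ^ 2 / 4 ^ k = (2 * l) ^ 2 / 4 ^ (k + 1) := by
    intro l
    rw [mul_pow, pow_succ' 4 k, show (2 : ℕ) ^ 2 = 4 by rfl, Nat.mul_div_mul_left _ _ (by norm_num)]
  have hstep : ∀ l, n ≤ l → l ^ 2 / 4 ^ (k + 1) < (l + 1) ^ 2 / 4 ^ (k + 1) := by
    intro l hl
    calc l ^ 2 / 4 ^ (k + 1) < (l ^ 2 + 4 ^ (k + 1)) / 4 ^ (k + 1) := by
          rw [Nat.add_div_right _ hc]; exact Nat.lt_succ_self _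
      _ ≤ (l + 1) ^ 2 / 4 ^ (k + 1) := Nat.div_le_div_right (by nlinarith)
  have h1 := hstep (2 * n) (by lia)
  have h2 := hstep (2 * n + 1) (by lia)
  rw [← hdouble] at h1
  rw [show 2 * n + 1 + 1 = 2 * (n + 1) by ring, ← hdouble] at h2
  have hgap : ∀ m, n ^ 2 / 4 ^ k < m → m < (n + 1) ^ 2 / 4 ^ k →
      m ∉ (scaledSquares k).marks := by
    rintro _ h3 h4 ⟨l, rfl⟩
    rcases le_or_gt l n with h | h
    · exact h3.not_ge (Nat.div_le_div_right (Nat.pow_le_pow_left h 2))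
    · exact h4.not_ge (Nat.div_le_div_right (Nat.pow_le_pow_left h 2))
  refine ⟨⟨2 * n, (hdouble n).symm⟩,
    (2 * n + 1) ^ 2 / 4 ^ (k + 1) - (n ^ 2 / 4 ^ k + 1), ⟨⟨2 * n + 1, by lia⟩, ?_⟩, ?_⟩
  · exact hgap _ (by lia) (by lia)
  · intro i hi
    exact hgap _ (by lia) (by lia)

theorem models_range_scaledSquares : refinementSentence.Models (Set.range scaledSquares) := by
  rw [models_refinementSentence]
  refine ⟨Set.range_nonempty _, ?_⟩
  rintro _ ⟨k, rfl⟩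
  exact ⟨exists_add_mem_marks_scaledSquares k, _, ⟨k + 1, rfl⟩, eventuallyRefines_scaledSquares k⟩

/-- There is a satisfiable HyperLTL sentence (over a finite set `AP`)
that is not satisfied by any set of traces containing an ultimately periodic trace:
in every model, no trace is ultimately periodic. -/
theorem hyperltl_no_model_with_ultimately_periodic_trace :
    ∃ (N : ℕ) (φ : HyperLTL (Fin N) ℕ), φ.Closed ∧
      (∃ T : Set (Trace (Fin N)), HyperLTL.Models T φ) ∧
      ∀ T : Set (Trace (Fin N)), HyperLTL.Models T φ →
        ∀ t ∈ T, ¬ UltimatelyPeriodic t := by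
  exact ⟨1, refinementSentence, refinementSentence_closed, ⟨_, models_range_scaledSquares⟩,
    fun _ hT _ ht => not_ultimatelyPeriodic_of_models hT ht⟩
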